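/- Suppose the decision-theoretic kernel p(W_V | F_A) obeys distributional consistency. Let B and C be disjoint subsets of A (C possibly empty), and let Y, W be disjoint subsets of V with B ⊆ W. If the conditional distribution p(W_Y = y | W_W = w, F_B = b, F_C = c) does not depend on the non-idle value b ∈ 𝔛_B (whenever the conditioning events have positive probability), then for all b ∈ 𝔛_B, c ∈ 𝔛_C, y, and all w ∈ 𝔛_W such that both p(W_W = w | F_B = b, F_C = c) > 0 and p(W_W = w | F_B = ∅, F_C = c) > 0: p(W_Y = y | W_W = w, F_B = b, F_C = c) = p(W_Y = y | W_W = w, F_B = ∅, F_C = c). -/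

import Mathlib

open Finset

namespace CausalPaper

variable {V : Type*} [Fintype V] [DecidableEq V]
variable {𝔛 : V → Type*} [∀ i, Fintype (𝔛 i)]

/-- Probability of the event `E` under the distribution `q` on joint assignments. -/
noncomputable def pr (q : (∀ i, 𝔛 i) → ℝ) (E : (∀ i, 𝔛 i) → Prop) : ℝ :=
  ∑ v : (∀ i, 𝔛 i), Set.indicator (setOf E) q v

/-- Conditional probability of `E` given `F` under `q`. -/
noncomputable def cpr (q : (∀ i, 𝔛 i) → ℝ) (E F : (∀ i, 𝔛 i) → Prop) : ℝ :=
  pr q (fun v => E v ∧ F v) / pr q F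

/-- `q` is a probability distribution on joint assignments. -/
def IsProb (q : (∀ i, 𝔛 i) → ℝ) : Prop :=
  (∀ v, 0 ≤ q v) ∧ (∑ v : (∀ i, 𝔛 i), q v) = 1

/-- `v` agrees with `s` on the coordinates in `S`. -/
def agree (S : Finset V) (s v : ∀ i, 𝔛 i) : Prop :=
  ∀ i ∈ S, v i = s i

/-- The intervention/regime that sets the variables in `B` according to `b`
(and is idle elsewhere). -/
def setOn (B : Finset V) (b : ∀ i, 𝔛 i) : ∀ i, Option (𝔛 i) :=
  fun i => if i ∈ B then some (b i) else none

/-- The intervention/regime that sets `B` according to `b` and `C` according to `c`. -/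
def setOn₂ (B : Finset V) (b : ∀ i, 𝔛 i) (C : Finset V) (c : ∀ i, 𝔛 i) :
    ∀ i, Option (𝔛 i) :=
  fun i => if i ∈ B then some (b i) else if i ∈ C then some (c i) else none

/-- The support of the partial intervention/regime `f` is contained in `A`. -/
def suppIn (f : ∀ i, Option (𝔛 i)) (A : Finset V) : Prop :=
  ∀ i, f i ≠ none → i ∈ A

/-- Distributional consistency: for `i ∈ A`, `C ⊆ A \ {i}`, the probability of the
event `{X_{V∖{i}} = y, X_i = b}` is the same whether or not `i` is additionally
intervened on and set to `b`. -/
def DistConsistent (A : Finset V) (P : (∀ i, Option (𝔛 i)) → (∀ i, 𝔛 i) → ℝ) : Prop :=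
  ∀ i ∈ A, ∀ C : Finset V, C ⊆ A \ {i} →
    ∀ (y : ∀ j, 𝔛 j) (b : 𝔛 i) (c : ∀ j, 𝔛 j),
      pr (P (Function.update (setOn C c) i (some b)))
          (fun v => agree (univ \ {i}) y v ∧ v i = b)
        = pr (P (setOn C c)) (fun v => agree (univ \ {i}) y v ∧ v i = b)

/-- The probability of `E` depends only on the masses of the points of `E`. -/
theorem pr_congr {q q' : (∀ i, 𝔛 i) → ℝ} {E : (∀ i, 𝔛 i) → Prop}
    (h : ∀ v, E v → q v = q' v) : pr q E = pr q' E := by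
  refine Finset.sum_congr rfl fun v _ => ?_
  by_cases hv : E v
  · have hv' : v ∈ setOf E := hv
    rw [Set.indicator_of_mem hv', Set.indicator_of_mem hv', h v hv]
  · have hv' : v ∉ setOf E := hv
    rw [Set.indicator_of_notMem hv', Set.indicator_of_notMem hv']

/-- The event that all coordinates agree with `y` has the point mass of `y` as probability. -/
theorem pr_agree_compl_singleton (q : (∀ i, 𝔛 i) → ℝ) (i : V) (y : ∀ j, 𝔛 j) :
    pr q (fun v => agree (univ \ {i}) y v ∧ v i = y i) = q y := by
  classical
  have hE : Set.ofPred (fun v => agree (univ \ {i}) y v ∧ v i = y i) = {y} := by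
    ext v
    simp only [Set.mem_ofPred_eq, Set.mem_singleton_iff]
    constructor
    · rintro ⟨h, hi⟩
      funext j
      by_cases hj : j = i
      · subst hj
        exact hi
      · exact h j (by simp [hj])
    · rintro rfl
      exact ⟨fun _ _ => rfl, rfl⟩
  change ∑ v, (Set.ofPred fun v => agree (univ \ {i}) y v ∧ v i = y i).indicator q v = q y
  rw [hE]
  simp [Set.indicator_apply]

/-- Under distributional consistency, intervening on `B` does not change the mass of the
assignments that agree with the intervention. -/
theorem DistConsistent.apply_setOn₂ {A : Finset V}
    {P : (∀ i, Option (𝔛 i)) → (∀ i, 𝔛 i) → ℝ} (hDC : DistConsistent A P)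
    {B C : Finset V} (hBA : B ⊆ A) (hCA : C ⊆ A) (hBC : Disjoint B C)
    (b c v : ∀ j, 𝔛 j) (hv : agree B b v) :
    P (setOn₂ B b C c) v = P (setOn C c) v := by
  induction B using Finset.induction_on with
  | empty =>
    have h : setOn₂ ∅ b C c = setOn C c := by
      funext j
      simp [setOn₂, setOn]
    rw [h]
  | insert i D hiD ih =>
    obtain ⟨hiA, hDA⟩ := Finset.insert_subset_iff.mp hBA
    obtain ⟨hiC, hDC'⟩ := Finset.disjoint_insert_left.mp hBC
    rw [← ih hDA hDC' fun j hj => hv j (Finset.mem_insert_of_mem hj)]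
    have hi : v i = b i := hv i (Finset.mem_insert_self i D)
    have hsub : D ∪ C ⊆ A \ {i} := by
      intro j hj
      rw [Finset.mem_sdiff, Finset.mem_singleton]
      refine ⟨Finset.union_subset hDA hCA hj, ?_⟩
      rintro rfl
      exact (Finset.mem_union.mp hj).elim hiD hiC
    have key := hDC i hiA (D ∪ C) hsub v (v i) (fun j => if j ∈ D then b j else c j)
    rw [pr_agree_compl_singleton, pr_agree_compl_singleton] at key
    have h₀ : setOn (D ∪ C) (fun j => if j ∈ D then b j else c j) = setOn₂ D b C c := by
      funext j
      by_cases hj : j ∈ D <;> simp [setOn, setOn₂, hj]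
    have h₁ : Function.update (setOn₂ D b C c) i (some (v i))
        = setOn₂ (insert i D) b C c := by
      funext j
      by_cases hj : j = i
      · subst hj
        simp [setOn₂, hi]
      · simp [setOn₂, hj]
    rwa [h₀, h₁] at key

/-- If the conditional of `W_Y` given `W_W` does not depend on the non-idle regime
value `b` for `B ⊆ W`, then it agrees with the conditional under `F_B = ∅`. -/
theorem stmt12_kernel_remove_b_from_conditional
    (A B C : Finset V) (hBA : B ⊆ A) (hCA : C ⊆ A) (hBC : Disjoint B C)
    (Y W : Finset V) (hYW : Disjoint Y W) (hBW : B ⊆ W)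
    (P : (∀ i, Option (𝔛 i)) → (∀ i, 𝔛 i) → ℝ)
    (hP : ∀ f, suppIn f A → IsProb (P f))
    (hDC : DistConsistent A P)
    (hIndep : ∀ (b b' c w y : ∀ j, 𝔛 j),
      0 < pr (P (setOn₂ B b C c)) (agree W w) →
      0 < pr (P (setOn₂ B b' C c)) (agree W w) →
      cpr (P (setOn₂ B b C c)) (agree Y y) (agree W w)
        = cpr (P (setOn₂ B b' C c)) (agree Y y) (agree W w)) :
    ∀ (b c y w : ∀ j, 𝔛 j),
      0 < pr (P (setOn₂ B b C c)) (agree W w) →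
      0 < pr (P (setOn C c)) (agree W w) →
      cpr (P (setOn₂ B b C c)) (agree Y y) (agree W w)
        = cpr (P (setOn C c)) (agree Y y) (agree W w) := by
  intro b c y w hb hidle
  have hmass : ∀ v, agree W w v → P (setOn₂ B w C c) v = P (setOn C c) v := fun v hv =>
    hDC.apply_setOn₂ hBA hCA hBC w c v fun j hj => hv j (hBW hj)
  have hden : pr (P (setOn₂ B w C c)) (agree W w) = pr (P (setOn C c)) (agree W w) :=
    pr_congr hmass
  rw [hIndep b w c w y hb (hden ▸ hidle)]
  unfold cpr
  rw [hden, pr_congr fun v hv => hmass v hv.2]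

end CausalPaper
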